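/- For every integer n ≥ 2, every ε ∈ (0,1/2), and every nontrivial monotone symmetric subset A of {0,1}^n, the threshold width satisfies τ(A,ε) ≤ log((1−ε)/ε) / s(n). -/

import Mathlib

open Finset

/-- Weight of a point `x ∈ {0,1}^n` under the product Bernoulli(p) measure:
`p^{∑ xᵢ} (1-p)^{∑ (1-xᵢ)}`. -/
noncomputable def muW (n : ℕ) (p : ℝ) (x : Fin n → Bool) : ℝ :=
  ∏ i : Fin n, if x i then p else 1 - p

/-- The measure `μ_{n,p}(A)` of a subset `A ⊆ {0,1}^n`. -/
noncomputable def muP (n : ℕ) (p : ℝ) (A : Finset (Fin n → Bool)) : ℝ :=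
  ∑ x ∈ A, muW n p x

/-- Expectation `∫ f dμ_{n,p}` of a real function on `{0,1}^n`. -/
noncomputable def muE (n : ℕ) (p : ℝ) (f : (Fin n → Bool) → ℝ) : ℝ :=
  ∑ x : Fin n → Bool, muW n p x * f x

/-- `A` is monotone: `x ∈ A` and `x ≤ y` coordinatewise imply `y ∈ A`. -/
def MonotoneSet (n : ℕ) (A : Finset (Fin n → Bool)) : Prop :=
  ∀ x ∈ A, ∀ y : Fin n → Bool, (∀ i, x i ≤ y i) → y ∈ A

/-- `A` is symmetric: invariant under a transitive subgroup of permutations of coordinates. -/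
def SymmetricSet (n : ℕ) (A : Finset (Fin n → Bool)) : Prop :=
  ∃ G : Subgroup (Equiv.Perm (Fin n)),
    (∀ i j : Fin n, ∃ g ∈ G, g i = j) ∧
    (∀ g ∈ G, ∀ x ∈ A, (fun i => x (g⁻¹ i)) ∈ A)

/-- Discrete gradient `∇_i f`. -/
noncomputable def grad (n : ℕ) (i : Fin n) (f : (Fin n → Bool) → ℝ)
    (x : Fin n → Bool) : ℝ :=
  f (Function.update x i true) - f (Function.update x i false)

/-- The operator `Δ_i f = f - ∫ f dμ_{1,p}(x_i)`. -/
noncomputable def del (n : ℕ) (p : ℝ) (i : Fin n) (f : (Fin n → Bool) → ℝ)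
    (x : Fin n → Bool) : ℝ :=
  f x - (p * f (Function.update x i true) + (1 - p) * f (Function.update x i false))

open Classical in
/-- Influence of coordinate `i` on a function `f`: the `μ_{n,p}`-probability
that `f` is not constant on the `i`-th fiber. -/
noncomputable def infl (n : ℕ) (p : ℝ) (i : Fin n) (f : (Fin n → Bool) → ℝ) : ℝ :=
  muP n p (Finset.univ.filter fun x =>
    f (Function.update x i true) ≠ f (Function.update x i false))

open Classical in
/-- Influence of coordinate `i` on a set `A`. -/
noncomputable def inflSet (n : ℕ) (p : ℝ) (i : Fin n) (A : Finset (Fin n → Bool)) : ℝ :=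
  muP n p (Finset.univ.filter fun x =>
    ¬((Function.update x i true ∈ A) ↔ (Function.update x i false ∈ A)))

/-- Entropy of a (nonnegative) function with respect to `μ_{n,p}`. -/
noncomputable def ent (n : ℕ) (p : ℝ) (g : (Fin n → Bool) → ℝ) : ℝ :=
  muE n p (fun x => g x * Real.log (g x)) - muE n p g * Real.log (muE n p g)

/-- Variance of a function with respect to `μ_{n,p}`. -/
noncomputable def varE (n : ℕ) (p : ℝ) (f : (Fin n → Bool) → ℝ) : ℝ :=
  muE n p (fun x => f x ^ 2) - (muE n p f) ^ 2

/-- Conditional expectation `E[f | x_1, …, x_j]` under `μ_{n,p}`: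
average over the last `n - j` coordinates. -/
noncomputable def condE (n : ℕ) (p : ℝ) (j : ℕ) (f : (Fin n → Bool) → ℝ)
    (x : Fin n → Bool) : ℝ :=
  ∑ y : Fin n → Bool,
    (∏ i : Fin n, if (i : ℕ) < j then (if y i = x i then (1 : ℝ) else 0)
      else (if y i then p else 1 - p)) * f y

/-- The logarithmic Sobolev constant of the two-point Bernoulli(p) space. -/
noncomputable def cLS (p : ℝ) : ℝ :=
  if p = 1 / 2 then 2 else (Real.log (1 - p) - Real.log p) / (1 - 2 * p)

/-- The sequence `s(n)` of Theorem 4.1. -/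
noncomputable def sseq (n : ℕ) : ℝ :=
  Real.log n -
    max (Real.log ((Real.exp 1 ^ (2 + 4 / Real.exp 1) / (2 : ℝ) ^ (5 + 4 / Real.exp 1)) *
        Real.log ((n : ℝ) / Real.log n ^ 2) ^ (3 + 4 / Real.exp 1)))
      (2 * Real.log (Real.log n))

/-! ### Coordinate averages -/

/-- Average over coordinate `i`. -/
noncomputable def cavg (n : ℕ) (p : ℝ) (i : Fin n) (f : (Fin n → Bool) → ℝ)
    (x : Fin n → Bool) : ℝ :=
  p * f (Function.update x i true) + (1 - p) * f (Function.update x i false)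

/-- Product of the weights away from coordinate `i`. -/
noncomputable def restW (n : ℕ) (p : ℝ) (i : Fin n) (x : Fin n → Bool) : ℝ :=
  ∏ j ∈ Finset.univ.erase i, if x j then p else 1 - p

lemma muW_split (n : ℕ) (p : ℝ) (i : Fin n) (x : Fin n → Bool) :
    muW n p x = (if x i then p else 1 - p) * restW n p i x := by
  unfold muW restW
  exact (Finset.mul_prod_erase Finset.univ (fun j => if x j then p else 1 - p)
    (Finset.mem_univ i)).symm

lemma restW_update (n : ℕ) (p : ℝ) (i : Fin n) (x : Fin n → Bool) (b : Bool) :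
    restW n p i (Function.update x i b) = restW n p i x := by
  unfold restW
  apply Finset.prod_congr rfl
  intro j hj
  rw [Function.update_of_ne (Finset.ne_of_mem_erase hj)]

/-- Flip of the coordinate `i`. -/
def flipC (n : ℕ) (i : Fin n) (x : Fin n → Bool) : Fin n → Bool :=
  Function.update x i (!(x i))

lemma flipC_invol (n : ℕ) (i : Fin n) : Function.Involutive (flipC n i) := by
  intro x
  unfold flipC
  simp

lemma sum_flip (n : ℕ) (i : Fin n) (G : (Fin n → Bool) → ℝ) :
    ∑ x, G (flipC n i x) = ∑ x, G x :=
  Equiv.sum_comp (flipC_invol n i).toPerm G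

lemma sum_eq_of_flip (n : ℕ) (i : Fin n) (G H : (Fin n → Bool) → ℝ)
    (h : ∀ x, G x + G (flipC n i x) = H x + H (flipC n i x)) :
    ∑ x, G x = ∑ x, H x := by
  have h1 : ∑ x, (G x + G (flipC n i x)) = ∑ x, (H x + H (flipC n i x)) :=
    Finset.sum_congr rfl fun x _ => h x
  rw [Finset.sum_add_distrib, Finset.sum_add_distrib, sum_flip, sum_flip] at h1
  linarith

lemma muE_cavg (n : ℕ) (p : ℝ) (i : Fin n) (f : (Fin n → Bool) → ℝ) :
    muE n p (cavg n p i f) = muE n p f := by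
  unfold muE
  apply sum_eq_of_flip n i
  intro x
  rw [muW_split n p i x, muW_split n p i (flipC n i x)]
  unfold flipC cavg
  rw [restW_update]
  simp only [Function.update_idem, Function.update_self]
  have hx : Function.update x i (x i) = x := Function.update_eq_self i x
  cases hb : x i <;> rw [hb] at hx <;> simp [hx] <;> ring

lemma russo_aux (n : ℕ) (p : ℝ) (i : Fin n) (f : (Fin n → Bool) → ℝ) :
    ∑ x, restW n p i x * (if x i then 1 else -1) * f x = muE n p (grad n i f) := by
  unfold muE
  apply sum_eq_of_flip n i
  intro x
  rw [muW_split n p i x, muW_split n p i (flipC n i x)]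
  unfold flipC grad
  rw [restW_update]
  simp only [Function.update_idem, Function.update_self]
  have hx : Function.update x i (x i) = x := Function.update_eq_self i x
  cases hb : x i <;> rw [hb] at hx <;> simp [hx] <;> ring

/-! ### Expectation basics -/

lemma muW_nonneg (n : ℕ) (p : ℝ) (hp : p ∈ Set.Icc (0 : ℝ) 1) (x) : 0 ≤ muW n p x := by
  unfold muW
  apply Finset.prod_nonneg
  intro i _
  split_ifs
  · exact hp.1
  · linarith [hp.2]

lemma muW_pos (n : ℕ) (p : ℝ) (hp : p ∈ Set.Ioo (0 : ℝ) 1) (x) : 0 < muW n p x := by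
  unfold muW
  apply Finset.prod_pos
  intro i _
  split_ifs
  · exact hp.1
  · linarith [hp.2]

lemma muE_mono (n : ℕ) (p : ℝ) (hp : p ∈ Set.Icc (0 : ℝ) 1) (f g : (Fin n → Bool) → ℝ)
    (h : ∀ x, f x ≤ g x) : muE n p f ≤ muE n p g :=
  Finset.sum_le_sum fun x _ => mul_le_mul_of_nonneg_left (h x) (muW_nonneg n p hp x)

lemma muE_nonneg (n : ℕ) (p : ℝ) (hp : p ∈ Set.Icc (0 : ℝ) 1) (f : (Fin n → Bool) → ℝ)
    (h : ∀ x, 0 ≤ f x) : 0 ≤ muE n p f :=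
  Finset.sum_nonneg fun x _ => mul_nonneg (muW_nonneg n p hp x) (h x)

lemma muE_add (n : ℕ) (p : ℝ) (f g : (Fin n → Bool) → ℝ) :
    muE n p (fun x => f x + g x) = muE n p f + muE n p g := by
  simp [muE, mul_add, Finset.sum_add_distrib]

lemma muE_sub (n : ℕ) (p : ℝ) (f g : (Fin n → Bool) → ℝ) :
    muE n p (fun x => f x - g x) = muE n p f - muE n p g := by
  simp [muE, mul_sub, Finset.sum_sub_distrib]

lemma muE_const_mul (n : ℕ) (p c : ℝ) (f : (Fin n → Bool) → ℝ) :
    muE n p (fun x => c * f x) = c * muE n p f := by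
  unfold muE
  rw [Finset.mul_sum]
  exact Finset.sum_congr rfl fun x _ => by ring

lemma sum_muW (n : ℕ) (p : ℝ) : ∑ x : Fin n → Bool, muW n p x = 1 := by
  unfold muW
  have := Finset.prod_univ_sum (fun _ : Fin n => (Finset.univ : Finset Bool))
    (fun _ b => if b then p else 1 - p)
  rw [Fintype.piFinset_univ] at this
  rw [← this]
  simp

lemma muE_const (n : ℕ) (p c : ℝ) : muE n p (fun _ => c) = c := by
  unfold muE
  rw [← Finset.sum_mul, sum_muW, one_mul]

/-! ### Algebra of averages -/

lemma cavg_comm (n : ℕ) (p : ℝ) (i j : Fin n) (f : (Fin n → Bool) → ℝ) :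
    cavg n p i (cavg n p j f) = cavg n p j (cavg n p i f) := by
  by_cases h : i = j
  · rw [h]
  · funext x
    unfold cavg
    simp only [Function.update_comm h]
    ring

lemma cavg_sub (n : ℕ) (p : ℝ) (i : Fin n) (f g : (Fin n → Bool) → ℝ) :
    cavg n p i (fun x => f x - g x) = fun x => cavg n p i f x - cavg n p i g x := by
  funext x
  unfold cavg
  ring

lemma cavg_update (n : ℕ) (p : ℝ) (i : Fin n) (f : (Fin n → Bool) → ℝ) (x) (b : Bool) :
    cavg n p i f (Function.update x i b) = cavg n p i f x := by
  simp [cavg]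

lemma muE_sq_sub_cavg (n : ℕ) (p : ℝ) (i : Fin n) (f : (Fin n → Bool) → ℝ) :
    muE n p (fun x => (f x - cavg n p i f x) ^ 2) =
      muE n p (fun x => f x ^ 2) - muE n p (fun x => cavg n p i f x ^ 2) := by
  rw [← muE_sub, ← muE_cavg n p i (fun x => (f x - cavg n p i f x) ^ 2),
    ← muE_cavg n p i (fun x => f x ^ 2 - cavg n p i f x ^ 2)]
  congr 1
  funext x
  simp only [cavg, Function.update_idem]
  ring

lemma grad_cavg_self (n : ℕ) (p : ℝ) (i : Fin n) (f : (Fin n → Bool) → ℝ) (x) :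
    grad n i (cavg n p i f) x = 0 := by
  simp [grad, cavg]

lemma grad_cavg (n : ℕ) (p : ℝ) (i j : Fin n) (h : i ≠ j) (f : (Fin n → Bool) → ℝ) :
    grad n i (cavg n p j f) = cavg n p j (grad n i f) := by
  funext x
  unfold grad cavg
  simp only [Function.update_comm h]
  ring

lemma muE_grad_sq (n : ℕ) (p : ℝ) (i k : Fin n) (f : (Fin n → Bool) → ℝ) :
    muE n p (fun x => (grad n i (fun y => f y - cavg n p k f y) x) ^ 2) =
      muE n p (fun x => grad n i f x ^ 2) - muE n p (fun x => grad n i (cavg n p k f) x ^ 2) := by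
  have hs : ∀ x, grad n i (fun y => f y - cavg n p k f y) x =
      grad n i f x - grad n i (cavg n p k f) x := by
    intro x
    unfold grad
    ring
  simp only [hs]
  by_cases h : i = k
  · subst h
    simp only [grad_cavg_self]
    simp [muE_const]
  · rw [grad_cavg n p i k h]
    exact muE_sq_sub_cavg n p k (grad n i f)

/-- Successive averages over the coordinates `< k`. -/
noncomputable def avgN (n : ℕ) (p : ℝ) : ℕ → ((Fin n → Bool) → ℝ) → ((Fin n → Bool) → ℝ)
  | 0, f => f
  | k + 1, f => if h : k < n then cavg n p ⟨k, h⟩ (avgN n p k f) else avgN n p k f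

lemma avgN_succ (n : ℕ) (p : ℝ) (k : Fin n) (f : (Fin n → Bool) → ℝ) :
    avgN n p (k + 1) f = cavg n p k (avgN n p k f) := by
  simp [avgN]

lemma muE_avgN (n : ℕ) (p : ℝ) (k : ℕ) (f : (Fin n → Bool) → ℝ) :
    muE n p (avgN n p k f) = muE n p f := by
  induction k with
  | zero => rfl
  | succ k ih =>
    simp only [avgN]
    split_ifs
    · rw [muE_cavg, ih]
    · exact ih

lemma avgN_sub_cavg (n : ℕ) (p : ℝ) (i : Fin n) (k : ℕ) (f : (Fin n → Bool) → ℝ) :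
    avgN n p k (fun x => f x - cavg n p i f x) =
      fun x => avgN n p k f x - cavg n p i (avgN n p k f) x := by
  induction k with
  | zero => rfl
  | succ k ih =>
    simp only [avgN]
    split_ifs
    · rw [ih, cavg_sub, cavg_comm]
    · exact ih

lemma muE_abs_avgN (n : ℕ) (p : ℝ) (hp : p ∈ Set.Icc (0 : ℝ) 1) (k : ℕ)
    (f : (Fin n → Bool) → ℝ) :
    muE n p (fun x => |avgN n p k f x|) ≤ muE n p (fun x => |f x|) := by
  induction k with
  | zero => exact le_rfl
  | succ k ih =>
    simp only [avgN]
    split_ifs with h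
    · refine le_trans ?_ ih
      rw [← muE_cavg n p ⟨k, h⟩ (fun x => |avgN n p k f x|)]
      apply muE_mono n p hp
      intro x
      unfold cavg
      refine (abs_add_le _ _).trans ?_
      rw [abs_mul, abs_mul, abs_of_nonneg hp.1, abs_of_nonneg (by linarith [hp.2] : (0:ℝ) ≤ 1 - p)]
    · exact ih

lemma avgN_update (n : ℕ) (p : ℝ) (f : (Fin n → Bool) → ℝ) (k : ℕ) (i : Fin n) (hi : (i : ℕ) < k)
    (x) (b : Bool) : avgN n p k f (Function.update x i b) = avgN n p k f x := by
  induction k generalizing x with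
  | zero => omega
  | succ k ih =>
    simp only [avgN]
    split_ifs with h
    · by_cases hk : i = ⟨k, h⟩
      · rw [hk]
        exact cavg_update n p _ _ x b
      · have hik : (i : ℕ) < k := by
          have : (i : ℕ) ≠ k := fun h' => hk (Fin.ext h')
          omega
        unfold cavg
        rw [Function.update_comm hk, Function.update_comm hk, ih hik, ih hik]
    · exact ih (by omega) x

lemma const_of_update (n : ℕ) (F : (Fin n → Bool) → ℝ)
    (h : ∀ i x b, F (Function.update x i b) = F x) (x y) : F x = F y := by
  have key : ∀ k : ℕ, k ≤ n → F (fun i => if (i : ℕ) < k then y i else x i) = F x := by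
    intro k
    induction k with
    | zero => intro _; simp
    | succ k ih =>
      intro hk
      rw [← ih (by omega), ← h ⟨k, by omega⟩ (fun i => if (i : ℕ) < k then y i else x i) (y ⟨k, by omega⟩)]
      congr 1
      funext i
      by_cases hi : i = ⟨k, by omega⟩
      · subst hi
        simp
      · have : (i : ℕ) ≠ k := fun h' => hi (Fin.ext h')
        rw [Function.update_of_ne hi]
        have h2 : (i : ℕ) < k + 1 ↔ (i : ℕ) < k := by omega
        simp only [h2]
  rw [← key n le_rfl]
  congr 1
  funext i
  simp

lemma avgN_full (n : ℕ) (p : ℝ) (f : (Fin n → Bool) → ℝ) (x) :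
    avgN n p n f x = muE n p f := by
  have h : avgN n p n f = fun _ => avgN n p n f x := by
    funext y
    exact const_of_update n _ (fun i x b => avgN_update n p f n i i.2 x b) y x
  rw [← muE_avgN n p n f, h, muE_const]

lemma telescope (n : ℕ) (a : ℕ → ℝ) : ∑ k : Fin n, (a k - a (k + 1)) = a 0 - a n := by
  rw [Fin.sum_univ_eq_sum_range (fun k => a k - a (k + 1)) n]
  exact Finset.sum_range_sub' a n

/-- Martingale increments. -/
noncomputable def incr (n : ℕ) (p : ℝ) (f : (Fin n → Bool) → ℝ) (k : Fin n)
    (x : Fin n → Bool) : ℝ :=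
  avgN n p k f x - cavg n p k (avgN n p k f) x

lemma incr_sq_sum (n : ℕ) (p : ℝ) (f : (Fin n → Bool) → ℝ) :
    ∑ k, muE n p (fun x => incr n p f k x ^ 2) = varE n p f := by
  have h : ∀ k : Fin n, muE n p (fun x => incr n p f k x ^ 2) =
      (fun k : ℕ => muE n p (fun x => avgN n p k f x ^ 2)) k -
      (fun k : ℕ => muE n p (fun x => avgN n p k f x ^ 2)) (k + 1) := by
    intro k
    unfold incr
    rw [muE_sq_sub_cavg]
    simp only [avgN_succ]
  rw [Finset.sum_congr rfl (fun k _ => h k),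
    telescope n (fun k : ℕ => muE n p (fun x => avgN n p k f x ^ 2))]
  simp only [avgN_full, muE_const, varE]
  rfl

lemma incr_grad_sum (n : ℕ) (p : ℝ) (hp : p ∈ Set.Icc (0 : ℝ) 1) (f : (Fin n → Bool) → ℝ)
    (i : Fin n) :
    ∑ k, muE n p (fun x => grad n i (incr n p f k) x ^ 2) ≤
      muE n p (fun x => grad n i f x ^ 2) := by
  have h : ∀ k : Fin n, muE n p (fun x => grad n i (incr n p f k) x ^ 2) =
      (fun k : ℕ => muE n p (fun x => grad n i (avgN n p k f) x ^ 2)) k -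
      (fun k : ℕ => muE n p (fun x => grad n i (avgN n p k f) x ^ 2)) (k + 1) := by
    intro k
    have := muE_grad_sq n p i k (avgN n p k f)
    simp only [avgN_succ]
    exact this
  rw [Finset.sum_congr rfl (fun k _ => h k),
    telescope n (fun k : ℕ => muE n p (fun x => grad n i (avgN n p k f) x ^ 2))]
  have h1 := muE_nonneg n p hp (fun x => grad n i (avgN n p n f) x ^ 2) (fun x => sq_nonneg _)
  have h0 : avgN n p 0 f = f := rfl
  simp only [h0]
  linarith

lemma incr_abs (n : ℕ) (p : ℝ) (hp : p ∈ Set.Icc (0 : ℝ) 1) (f : (Fin n → Bool) → ℝ)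
    (k : Fin n) :
    muE n p (fun x => |incr n p f k x|) ≤ 1 / 2 * muE n p (fun x => |grad n k f x|) := by
  have h := muE_abs_avgN n p hp k (fun x => f x - cavg n p k f x)
  rw [avgN_sub_cavg] at h
  refine le_trans h ?_
  rw [← muE_cavg n p k, ← muE_const_mul]
  apply muE_mono n p hp
  intro x
  simp only [cavg, Function.update_idem, grad]
  set a := f (Function.update x k true)
  set b := f (Function.update x k false)
  have e1 : a - (p * a + (1 - p) * b) = (1 - p) * (a - b) := by ring
  have e2 : b - (p * a + (1 - p) * b) = - (p * (a - b)) := by ring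
  rw [e1, e2, abs_neg, abs_mul, abs_mul, abs_of_nonneg hp.1,
    abs_of_nonneg (by linarith [hp.2] : (0:ℝ) ≤ 1 - p)]
  nlinarith [abs_nonneg (a - b), mul_nonneg (abs_nonneg (a - b)) (sq_nonneg (2 * p - 1))]

/-! ### Two-point logarithmic Sobolev inequality -/

lemma two_point_aux (u : ℝ) (hu : -1 < u) :
    2 * Real.log (1 + u) - Real.log (1 + u ^ 2 / 3) ≤ 1 + (5 * u ^ 2 / 3 - 1) / (1 + u) ^ 2 := by
  set D : ℝ → ℝ := fun u => 1 + (5 * u ^ 2 / 3 - 1) / (1 + u) ^ 2 -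
    (2 * Real.log (1 + u) - Real.log (1 + u ^ 2 / 3)) with hD
  have hder : ∀ v : ℝ, -1 < v →
      HasDerivAt D ((16 / 3 * v ^ 3) / ((1 + v) ^ 3 * (3 + v ^ 2))) v := by
    intro v hv
    have h1 : (1 + v) ≠ 0 := by linarith
    have h2 : (1 + v ^ 2 / 3) ≠ 0 := by positivity
    have h3 : (3 + v ^ 2) ≠ 0 := by positivity
    have d1 : HasDerivAt (fun u : ℝ => 1 + u) 1 v := (hasDerivAt_id v).const_add 1
    have d2 : HasDerivAt (fun u : ℝ => u ^ 2) (2 * v) v := by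
      simpa using hasDerivAt_pow 2 v
    have d3 : HasDerivAt (fun u : ℝ => 1 + u ^ 2 / 3) (2 * v / 3) v := (d2.div_const 3).const_add 1
    have d4 : HasDerivAt (fun u : ℝ => 5 * u ^ 2 / 3 - 1) (5 * (2 * v) / 3) v :=
      ((d2.const_mul 5).div_const 3).sub_const 1
    have d5 : HasDerivAt (fun u : ℝ => (1 + u) ^ 2) (2 * (1 + v)) v := by
      have := d1.fun_pow 2
      simpa using this
    have := ((d4.div d5 (pow_ne_zero 2 h1)).const_add 1).sub
      (((d1.log h1).const_mul 2).sub (d3.log h2))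
    refine this.congr_deriv ?_
    field_simp
    ring
  have h0 : D 0 = 0 := by simp [hD]
  have hcont : ContinuousOn D (Set.Ioi (-1)) := fun v hv => (hder v hv).continuousAt.continuousWithinAt
  suffices h : 0 ≤ D u by
    simp only [hD] at h
    linarith
  rcases le_total 0 u with h | h
  · rw [← h0]
    have : MonotoneOn D (Set.Icc 0 u) := by
      apply monotoneOn_of_deriv_nonneg (convex_Icc 0 u)
      · exact hcont.mono fun v hv => by
          have := hv.1
          simp only [Set.mem_Ioi]
          linarith
      · intro v hv
        rw [interior_Icc] at hv
        exact (hder v (by linarith [hv.1])).differentiableAt.differentiableWithinAt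
      · intro v hv
        rw [interior_Icc] at hv
        rw [(hder v (by linarith [hv.1])).deriv]
        have := hv.1
        positivity
    exact this ⟨le_rfl, h⟩ ⟨h, le_rfl⟩ h
  · rw [← h0]
    have : AntitoneOn D (Set.Icc u 0) := by
      apply antitoneOn_of_deriv_nonpos (convex_Icc u 0)
      · exact hcont.mono fun v hv => by
          have := hv.1
          simp only [Set.mem_Ioi]
          linarith
      · intro v hv
        rw [interior_Icc] at hv
        exact (hder v (by linarith [hv.1])).differentiableAt.differentiableWithinAt
      · intro v hv
        rw [interior_Icc] at hv
        have hv1 : 0 < 1 + v := by linarith [hv.1]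
        rw [(hder v (by linarith [hv.1])).deriv]
        apply div_nonpos_of_nonpos_of_nonneg
        · have : v ^ 3 = v * v ^ 2 := by ring
          rw [this]
          nlinarith [mul_nonneg (by linarith [hv.2] : 0 ≤ -v) (sq_nonneg v)]
        · positivity
    exact this ⟨le_rfl, h⟩ ⟨h, le_rfl⟩ h

/-- One-sided bound, normalised so that the points are `r (1+u)` and `r (1-u)`. -/
lemma two_point_phi (r u : ℝ) (hr : 0 < r) (hu : -1 ≤ u) (hu1 : u ≤ 1) :
    (r * (1 + u)) ^ 2 * Real.log ((r * (1 + u)) ^ 2)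
      - (r * (1 + u)) ^ 2 * Real.log (r ^ 2 * (1 + u ^ 2 / 3))
      - (r * (1 + u)) ^ 2 + r ^ 2 * (1 + u ^ 2 / 3) ≤ 2 * (r * u) ^ 2 := by
  rcases hu.eq_or_lt with h | h
  · subst h
    norm_num
    nlinarith [sq_nonneg r]
  · have h1 : 0 < 1 + u := by linarith
    have h2 : 0 < 1 + u ^ 2 / 3 := by positivity
    have key := two_point_aux u h
    have l1 : Real.log ((r * (1 + u)) ^ 2) = 2 * Real.log r + 2 * Real.log (1 + u) := by
      rw [Real.log_pow, Real.log_mul hr.ne' h1.ne']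
      push_cast
      ring
    have l2 : Real.log (r ^ 2 * (1 + u ^ 2 / 3)) = 2 * Real.log r + Real.log (1 + u ^ 2 / 3) := by
      rw [Real.log_mul (by positivity) h2.ne', Real.log_pow]
      push_cast
      ring
    rw [l1, l2]
    have h3 : 0 < (r * (1 + u)) ^ 2 := by positivity
    have k2 := mul_le_mul_of_nonneg_left key h3.le
    have k3 : (r * (1 + u)) ^ 2 * (1 + (5 * u ^ 2 / 3 - 1) / (1 + u) ^ 2) =
        (r * (1 + u)) ^ 2 + r ^ 2 * (5 * u ^ 2 / 3 - 1) := by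
      field_simp
    rw [k3] at k2
    nlinarith [k2]

lemma two_point_LS (p : ℝ) (hp : p ∈ Set.Icc (0 : ℝ) 1) (a b : ℝ) (ha : 0 ≤ a) (hb : 0 ≤ b) :
    p * (a ^ 2 * Real.log (a ^ 2)) + (1 - p) * (b ^ 2 * Real.log (b ^ 2))
      - (p * a ^ 2 + (1 - p) * b ^ 2) * Real.log (p * a ^ 2 + (1 - p) * b ^ 2)
      ≤ 1 / 2 * (a - b) ^ 2 := by
  obtain ⟨hp0, hp1⟩ := hp
  have hq : 0 ≤ 1 - p := by linarith
  rcases (add_nonneg ha hb).eq_or_lt with h0 | hpos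
  · have ha0 : a = 0 := by linarith
    have hb0 : b = 0 := by linarith
    subst ha0 hb0
    simp
  set r := (a + b) / 2 with hr
  have hrpos : 0 < r := by positivity
  set u := (a - b) / (a + b) with hu
  have hra : r * (1 + u) = a := by
    rw [hr, hu]; field_simp; ring
  have hrb : r * (1 + -u) = b := by
    rw [hr, hu]; field_simp; ring
  have hru : 2 * (r * u) ^ 2 = 1 / 2 * (a - b) ^ 2 := by
    rw [hr, hu]; field_simp
  have hu1 : u ≤ 1 := by
    rw [hu, div_le_one hpos]; linarith
  have hu2 : -1 ≤ u := by
    rw [hu, le_div_iff₀ hpos]; linarith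
  have A1 := two_point_phi r u hrpos hu2 hu1
  have B1 := two_point_phi r (-u) hrpos (by linarith) (by linarith)
  rw [hra, hru] at A1
  rw [hrb, neg_sq, mul_neg, neg_sq, hru] at B1
  set t := r ^ 2 * (1 + u ^ 2 / 3) with ht
  have htpos : 0 < t := by positivity
  set m := p * a ^ 2 + (1 - p) * b ^ 2 with hm
  have hmnn : 0 ≤ m := by positivity
  -- `m log m ≥ m log t + m - t`
  have hml : m * Real.log t + m - t ≤ m * Real.log m := by
    rcases hmnn.eq_or_lt with h | h
    · rw [← h]; simp [htpos.le]
    · have := Real.log_le_sub_one_of_pos (div_pos htpos h)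
      rw [Real.log_div htpos.ne' h.ne'] at this
      have k := mul_le_mul_of_nonneg_left this hmnn
      have e : m * (t / m - 1) = t - m := by field_simp
      rw [e] at k
      linarith
  have k1 := mul_le_mul_of_nonneg_left A1 hp0
  have k2 := mul_le_mul_of_nonneg_left B1 hq
  have e : m * Real.log t = p * (a ^ 2 * Real.log t) + (1 - p) * (b ^ 2 * Real.log t) := by
    rw [hm]; ring
  nlinarith [k1, k2, hml, e, hm]

/-! ### Numerical facts on `sseq` -/

lemma lin4e : (1.47 : ℝ) < 4 / Real.exp 1 ∧ 4 / Real.exp 1 < 1.472 := by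
  have h1 := Real.exp_one_gt_d9
  have h2 := Real.exp_one_lt_d9
  constructor
  · rw [lt_div_iff₀ (by positivity)]; linarith
  · rw [div_lt_iff₀ (by positivity)]; linarith

lemma logK : Real.log (Real.exp 1 ^ (2 + 4 / Real.exp 1) / (2 : ℝ) ^ (5 + 4 / Real.exp 1)) =
    (2 + 4 / Real.exp 1) - (5 + 4 / Real.exp 1) * Real.log 2 := by
  rw [Real.log_div (by positivity) (by positivity), Real.log_rpow (by positivity),
    Real.log_rpow (by positivity), Real.log_exp, mul_one]

lemma log_two_sq_bounds : (4 : ℝ) ≤ 2 / Real.log 2 ^ 2 ∧ 2 / Real.log 2 ^ 2 ≤ 4.2 := by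
  have h1 := Real.log_two_gt_d9
  have h2 := Real.log_two_lt_d9
  have h3 : 0 < Real.log 2 ^ 2 := by positivity
  constructor
  · rw [le_div_iff₀ h3]; nlinarith
  · rw [div_le_iff₀ h3]; nlinarith

lemma firstTerm (y : ℝ) (hy : 0 < y) :
    Real.log ((Real.exp 1 ^ (2 + 4 / Real.exp 1) / (2 : ℝ) ^ (5 + 4 / Real.exp 1)) *
        y ^ (3 + 4 / Real.exp 1)) =
    (2 + 4 / Real.exp 1) - (5 + 4 / Real.exp 1) * Real.log 2 + (3 + 4 / Real.exp 1) * Real.log y := by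
  rw [Real.log_mul (by positivity) (by positivity), logK, Real.log_rpow hy]

lemma sseq_two : 0 < sseq 2 ∧ sseq 2 ≤ 2 * Real.log 2 ∧
    sseq 2 ≤ Real.log 2 - 2 * Real.log (Real.log 2) := by
  have h1 := Real.log_two_gt_d9
  have h2 := Real.log_two_lt_d9
  obtain ⟨e1, e2⟩ := lin4e
  obtain ⟨b1, b2⟩ := log_two_sq_bounds
  set y := Real.log (2 / Real.log 2 ^ 2) with hy
  have hylow : 1.386 ≤ y := by
    have : Real.log 4 ≤ y := Real.log_le_log (by norm_num) b1
    have h4 : Real.log 4 = 2 * Real.log 2 := by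
      rw [show (4:ℝ) = 2 ^ 2 by norm_num, Real.log_pow]; norm_num
    linarith
  have hyup : y ≤ 1.44 := by
    rw [hy, Real.log_le_iff_le_exp (by linarith)]
    refine b2.trans ?_
    have : Real.exp 1.44 = Real.exp 1 * Real.exp 0.44 := by
      rw [← Real.exp_add]; norm_num
    rw [this]
    have h3 := Real.quadratic_le_exp_of_nonneg (x := 0.44) (by norm_num)
    have h4 := Real.exp_one_gt_d9
    have h5 : (1.552 : ℝ) ≤ Real.exp 0.44 := by
      have := Real.sum_le_exp_of_nonneg (x := 0.44) (by norm_num) 5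
      simp [Finset.sum_range_succ, Nat.factorial] at this
      norm_num at this ⊢
      linarith
    nlinarith
  have hypos : 0 < y := by linarith
  have ly1 : Real.log y ≤ 0.37 := by
    rw [Real.log_le_iff_le_exp hypos]
    refine hyup.trans ?_
    have := Real.sum_le_exp_of_nonneg (x := 0.37) (by norm_num) 5
    simp [Finset.sum_range_succ, Nat.factorial] at this
    norm_num at this ⊢
    linarith
  have ly2 : 0.27 ≤ Real.log y := by
    have h := Real.one_sub_inv_le_log_of_pos hypos
    have : y⁻¹ ≤ 0.73 := by
      rw [inv_le_comm₀ hypos (by norm_num)]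
      norm_num at hylow ⊢
      linarith
    linarith
  have ll : Real.log (Real.log 2) ≤ 0 := Real.log_nonpos (by linarith) (by linarith)
  unfold sseq
  push_cast
  rw [← hy, firstTerm y hypos]
  set c := 4 / Real.exp 1
  refine ⟨?_, ?_, ?_⟩
  · have : max ((2 + c) - (5 + c) * Real.log 2 + (3 + c) * Real.log y) (2 * Real.log (Real.log 2))
        < Real.log 2 := by
      apply max_lt
      · nlinarith
      · linarith
    linarith
  · have := le_max_left ((2 + c) - (5 + c) * Real.log 2 + (3 + c) * Real.log y)
      (2 * Real.log (Real.log 2))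
    nlinarith
  · have := le_max_right ((2 + c) - (5 + c) * Real.log 2 + (3 + c) * Real.log y)
      (2 * Real.log (Real.log 2))
    linarith

lemma sseq_three (n : ℕ) (hn : 3 ≤ n) : 0 < sseq n ∧ sseq n ≤ 2 * Real.log n ∧
    sseq n ≤ Real.log n - 2 * Real.log (Real.log n) := by
  have h1 := Real.log_two_gt_d9
  have h2 := Real.log_two_lt_d9
  obtain ⟨e1, e2⟩ := lin4e
  have hn' : (3 : ℝ) ≤ n := by exact_mod_cast hn
  have hx1 : 1 ≤ Real.log n := by
    rw [Real.le_log_iff_exp_le (by linarith)]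
    have := Real.exp_one_lt_d9
    linarith
  have hll : 0 ≤ Real.log (Real.log n) := Real.log_nonneg hx1
  have hlog : ∀ z : ℝ, 0 < z → Real.log z ≤ z / Real.exp 1 := by
    intro z hz
    have := Real.log_le_sub_one_of_pos (div_pos hz (Real.exp_pos 1))
    rw [Real.log_div hz.ne' (Real.exp_pos 1).ne', Real.log_exp] at this
    linarith
  have hyeq : Real.log ((n : ℝ) / Real.log n ^ 2) = Real.log n - 2 * Real.log (Real.log n) := by
    rw [Real.log_div (by positivity) (by positivity), Real.log_pow]
    push_cast
    ring
  set x := Real.log n with hx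
  have hxpos : 0 < x := by linarith
  have hypos : 0 < x - 2 * Real.log x := by
    have := hlog x hxpos
    have he := Real.exp_one_gt_d9
    have : x / Real.exp 1 < x / 2 := by
      apply div_lt_div_of_pos_left hxpos (by norm_num); linarith
    linarith
  unfold sseq
  rw [← hx, hyeq]
  set y := x - 2 * Real.log x with hy
  rw [firstTerm y hypos]
  have hyx : Real.log y ≤ Real.log x := Real.log_le_log hypos (by linarith)
  have hly := hlog y hypos
  have hly' : y / Real.exp 1 ≤ 0.368 * y := by
    rw [div_le_iff₀ (Real.exp_pos 1)]
    have he := Real.exp_one_gt_d9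
    nlinarith
  set c := 4 / Real.exp 1
  refine ⟨?_, ?_, ?_⟩
  · have : max ((2 + c) - (5 + c) * Real.log 2 + (3 + c) * Real.log y) (2 * Real.log x) < x := by
      apply max_lt
      · have k1 : (2 + c) - (5 + c) * Real.log 2 < 0 := by nlinarith
        have k2 : (1 + c) * Real.log y ≤ (1 + c) * (0.368 * y) :=
          mul_le_mul_of_nonneg_left (by linarith) (by linarith)
        have k3 : (1 + c) * (0.368 * y) ≤ y := by nlinarith
        nlinarith
      · linarith
    linarith
  · have := le_max_right ((2 + c) - (5 + c) * Real.log 2 + (3 + c) * Real.log y) (2 * Real.log x)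
    linarith
  · have := le_max_right ((2 + c) - (5 + c) * Real.log 2 + (3 + c) * Real.log y) (2 * Real.log x)
    linarith

lemma sseq_bounds (n : ℕ) (hn : 2 ≤ n) : 0 < sseq n ∧ sseq n ≤ 2 * Real.log n ∧
    sseq n ≤ Real.log n - 2 * Real.log (Real.log n) := by
  rcases hn.eq_or_lt with h | h
  · subst h
    exact_mod_cast sseq_two
  · exact sseq_three n h

/-! ### Logarithmic Sobolev inequality on the cube -/

lemma avgN_nonneg (n : ℕ) (p : ℝ) (hp : p ∈ Set.Icc (0 : ℝ) 1) (k : ℕ)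
    (h : (Fin n → Bool) → ℝ) (hh : ∀ x, 0 ≤ h x) (x) : 0 ≤ avgN n p k h x := by
  have hq : 0 ≤ 1 - p := by linarith [hp.2]
  induction k generalizing x with
  | zero => exact hh x
  | succ k ih =>
    simp only [avgN]
    split_ifs
    · unfold cavg
      exact add_nonneg (mul_nonneg hp.1 (ih _)) (mul_nonneg hq (ih _))
    · exact ih x

lemma minkowski_two (p : ℝ) (hp : p ∈ Set.Icc (0 : ℝ) 1) (a c b d : ℝ)
    (ha : 0 ≤ a) (hc : 0 ≤ c) (hb : 0 ≤ b) (hd : 0 ≤ d) :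
    (Real.sqrt (p * a + (1 - p) * c) - Real.sqrt (p * b + (1 - p) * d)) ^ 2 ≤
      p * (Real.sqrt a - Real.sqrt b) ^ 2 + (1 - p) * (Real.sqrt c - Real.sqrt d) ^ 2 := by
  have hq : 0 ≤ 1 - p := by linarith [hp.2]
  have hp0 := hp.1
  have hX : 0 ≤ p * a + (1 - p) * c := by positivity
  have hY : 0 ≤ p * b + (1 - p) * d := by positivity
  have sa := Real.sq_sqrt ha
  have sb := Real.sq_sqrt hb
  have sc := Real.sq_sqrt hc
  have sd := Real.sq_sqrt hd
  have sX := Real.sq_sqrt hX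
  have sY := Real.sq_sqrt hY
  have na := Real.sqrt_nonneg a
  have nb := Real.sqrt_nonneg b
  have nc := Real.sqrt_nonneg c
  have nd := Real.sqrt_nonneg d
  have nX := Real.sqrt_nonneg (p * a + (1 - p) * c)
  have nY := Real.sqrt_nonneg (p * b + (1 - p) * d)
  have key : p * (Real.sqrt a * Real.sqrt b) + (1 - p) * (Real.sqrt c * Real.sqrt d) ≤
      Real.sqrt (p * a + (1 - p) * c) * Real.sqrt (p * b + (1 - p) * d) := by
    apply le_of_sq_le_sq _ (mul_nonneg nX nY)
    rw [mul_pow, sX, sY]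
    generalize Real.sqrt a = a' at *
    generalize Real.sqrt b = b' at *
    generalize Real.sqrt c = c' at *
    generalize Real.sqrt d = d' at *
    rw [← sa, ← sb, ← sc, ← sd]
    nlinarith [mul_nonneg (mul_nonneg hp0 hq) (sq_nonneg (a' * d' - b' * c'))]
  rw [sub_sq, sub_sq, sub_sq, sX, sY, sa, sb, sc, sd]
  linarith

lemma grad_sqrt_cavg (n : ℕ) (p : ℝ) (hp : p ∈ Set.Icc (0 : ℝ) 1) (i j : Fin n) (hij : i ≠ j)
    (h : (Fin n → Bool) → ℝ) (hh : ∀ x, 0 ≤ h x) :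
    muE n p (fun x => grad n i (fun y => Real.sqrt (cavg n p j h y)) x ^ 2) ≤
      muE n p (fun x => grad n i (fun y => Real.sqrt (h y)) x ^ 2) := by
  rw [← muE_cavg n p j (fun x => grad n i (fun y => Real.sqrt (h y)) x ^ 2)]
  apply muE_mono n p hp
  intro x
  simp only [grad, cavg]
  simp only [Function.update_comm hij]
  exact minkowski_two p hp _ _ _ _ (hh _) (hh _) (hh _) (hh _)

lemma grad_sqrt_avgN (n : ℕ) (p : ℝ) (hp : p ∈ Set.Icc (0 : ℝ) 1) (i : Fin n) (k : ℕ)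
    (hk : k ≤ i) (h : (Fin n → Bool) → ℝ) (hh : ∀ x, 0 ≤ h x) :
    muE n p (fun x => grad n i (fun y => Real.sqrt (avgN n p k h y)) x ^ 2) ≤
      muE n p (fun x => grad n i (fun y => Real.sqrt (h y)) x ^ 2) := by
  induction k with
  | zero => exact le_rfl
  | succ k ih =>
    refine le_trans ?_ (ih (by omega))
    simp only [avgN]
    split_ifs with hkn
    · apply grad_sqrt_cavg n p hp i ⟨k, hkn⟩ _ _ (avgN_nonneg n p hp k h hh)
      intro h'
      have := congrArg Fin.val h'
      simp at this
      omega
    · exact le_rfl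

lemma ent_step (n : ℕ) (p : ℝ) (hp : p ∈ Set.Icc (0 : ℝ) 1) (i : Fin n)
    (h : (Fin n → Bool) → ℝ) (hh : ∀ x, 0 ≤ h x) :
    muE n p (fun x => h x * Real.log (h x)) -
      muE n p (fun x => cavg n p i h x * Real.log (cavg n p i h x)) ≤
      1 / 2 * muE n p (fun x => grad n i (fun y => Real.sqrt (h y)) x ^ 2) := by
  rw [← muE_cavg n p i (fun x => h x * Real.log (h x)), ← muE_sub, ← muE_const_mul]
  apply muE_mono n p hp
  intro x
  simp only [grad, cavg]
  have := two_point_LS p hp _ _ (Real.sqrt_nonneg (h (Function.update x i true)))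
    (Real.sqrt_nonneg (h (Function.update x i false)))
  rw [Real.sq_sqrt (hh _), Real.sq_sqrt (hh _)] at this
  exact this

lemma log_sobolev (n : ℕ) (p : ℝ) (hp : p ∈ Set.Icc (0 : ℝ) 1) (g : (Fin n → Bool) → ℝ) :
    ent n p (fun x => g x ^ 2) ≤ 1 / 2 * ∑ i, muE n p (fun x => grad n i g x ^ 2) := by
  set h : (Fin n → Bool) → ℝ := fun x => g x ^ 2 with hdef
  have hh : ∀ x, 0 ≤ h x := fun x => sq_nonneg _
  have htel := telescope n (fun k : ℕ =>
    muE n p (fun x => avgN n p k h x * Real.log (avgN n p k h x)))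
  simp only [avgN_full, muE_const] at htel
  have : ent n p h = ∑ k : Fin n, (muE n p (fun x => avgN n p k h x * Real.log (avgN n p k h x)) -
      muE n p (fun x => avgN n p (k + 1) h x * Real.log (avgN n p (k + 1) h x))) := by
    rw [htel]
    rfl
  rw [this, Finset.mul_sum]
  apply Finset.sum_le_sum
  intro k _
  simp only [avgN_succ]
  refine (ent_step n p hp k _ (avgN_nonneg n p hp k h hh)).trans ?_
  apply mul_le_mul_of_nonneg_left _ (by norm_num)
  refine (grad_sqrt_avgN n p hp k k le_rfl h hh).trans ?_
  apply muE_mono n p hp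
  intro x
  simp only [grad, hdef, Real.sqrt_sq_eq_abs]
  exact sq_le_sq.mpr (abs_abs_sub_abs_le _ _)

lemma ent_lower (n : ℕ) (p : ℝ) (hp : p ∈ Set.Icc (0 : ℝ) 1) (g : (Fin n → Bool) → ℝ)
    (hm : 0 < muE n p (fun x => g x ^ 2)) (hl : 0 < muE n p (fun x => |g x|)) :
    muE n p (fun x => g x ^ 2) * (Real.log (muE n p (fun x => g x ^ 2)) -
      2 * Real.log (muE n p (fun x => |g x|))) ≤ ent n p (fun x => g x ^ 2) := by
  set m := muE n p (fun x => g x ^ 2) with hmd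
  set l := muE n p (fun x => |g x|) with hld
  have ht : 0 < m / l := div_pos hm hl
  have pt : ∀ x, (2 * Real.log (m / l) + 2) * g x ^ 2 - 2 * (m / l) * |g x| ≤
      g x ^ 2 * Real.log (g x ^ 2) := by
    intro x
    by_cases hx : g x = 0
    · simp [hx]
    · have ha : 0 < |g x| := abs_pos.mpr hx
      have k := Real.log_le_sub_one_of_pos (div_pos ht ha)
      rw [Real.log_div ht.ne' ha.ne'] at k
      have k2 := mul_le_mul_of_nonneg_left k (sq_nonneg (g x))
      have e : g x ^ 2 * (m / l / |g x| - 1) = m / l * |g x| - g x ^ 2 := by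
        rw [← sq_abs (g x)]
        field_simp
      rw [e] at k2
      rw [Real.log_pow, ← Real.log_abs (g x)]
      push_cast
      linarith
  have := muE_mono n p hp _ _ pt
  rw [muE_sub, muE_const_mul, muE_const_mul, ← hmd, ← hld] at this
  rw [Real.log_div hm.ne' hl.ne'] at this
  have e : 2 * (m / l) * l = 2 * m := by field_simp
  rw [e] at this
  unfold ent
  rw [← hmd]
  linarith

/-- Main functional inequality. -/
lemma main_ineq (n : ℕ) (p : ℝ) (hp : p ∈ Set.Ioo (0 : ℝ) 1) (f : (Fin n → Bool) → ℝ)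
    (b : ℝ) (hV : 0 < varE n p f)
    (hb : ∀ i, muE n p (fun x => |grad n i f x|) ≤ 2 * b) :
    0 < b ∧ varE n p f * (Real.log (varE n p f / n) - 2 * Real.log b) ≤
      1 / 2 * ∑ i, muE n p (fun x => grad n i f x ^ 2) := by
  have hp' : p ∈ Set.Icc (0 : ℝ) 1 := ⟨hp.1.le, hp.2.le⟩
  set m : Fin n → ℝ := fun k => muE n p (fun x => incr n p f k x ^ 2) with hm
  set l : Fin n → ℝ := fun k => muE n p (fun x => |incr n p f k x|) with hl
  have hmnn : ∀ k, 0 ≤ m k := fun k => muE_nonneg n p hp' _ fun x => sq_nonneg _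
  have hlb : ∀ k, l k ≤ b := fun k => by
    have := incr_abs n p hp' f k
    have h2 := hb k
    simp only [hl]
    linarith
  have hsum : ∑ k, m k = varE n p f := incr_sq_sum n p f
  have hlpos : ∀ k, 0 < m k → 0 < l k := by
    intro k hk
    have : ∃ x, incr n p f k x ≠ 0 := by
      by_contra hcon
      push Not at hcon
      simp only [hm, hcon] at hk
      simp [muE] at hk
    obtain ⟨x, hx⟩ := this
    apply Finset.sum_pos'
    · intro y _
      exact mul_nonneg (muW_nonneg n p hp' y) (abs_nonneg _)
    · exact ⟨x, Finset.mem_univ x, mul_pos (muW_pos n p hp x) (abs_pos.mpr hx)⟩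
  obtain ⟨k0, hk0⟩ : ∃ k, 0 < m k := by
    by_contra hcon
    push Not at hcon
    have : ∑ k, m k ≤ 0 := Finset.sum_nonpos fun k _ => hcon k
    linarith
  have hbpos : 0 < b := (hlpos k0 hk0).trans_le (hlb k0)
  refine ⟨hbpos, ?_⟩
  have hn : (0 : ℝ) < n := by
    have := k0.pos
    exact_mod_cast this
  set V := varE n p f with hVd
  have hc : 0 < V / n := div_pos hV hn
  have step : ∀ k, m k * (Real.log (V / n) - 2 * Real.log b) + m k - V / n ≤
      1 / 2 * ∑ i, muE n p (fun x => grad n i (incr n p f k) x ^ 2) := by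
    intro k
    rcases (hmnn k).eq_or_lt with h0 | hpos
    · rw [← h0]
      have : 0 ≤ ∑ i, muE n p (fun x => grad n i (incr n p f k) x ^ 2) :=
        Finset.sum_nonneg fun i _ => muE_nonneg n p hp' _ fun x => sq_nonneg _
      linarith
    · have a1 := ent_lower n p hp' (incr n p f k) hpos (hlpos k hpos)
      have a2 := log_sobolev n p hp' (incr n p f k)
      have a3 : Real.log (l k) ≤ Real.log b := Real.log_le_log (hlpos k hpos) (hlb k)
      have a4 := Real.log_le_sub_one_of_pos (div_pos hc hpos)
      rw [Real.log_div hc.ne' hpos.ne'] at a4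
      have a5 := mul_le_mul_of_nonneg_left a4 hpos.le
      have e : m k * (V / n / m k - 1) = V / n - m k := by field_simp
      rw [e] at a5
      have a6 := mul_le_mul_of_nonneg_left a3 hpos.le
      have a7 : m k * (Real.log (m k) - 2 * Real.log (l k)) ≤
        1 / 2 * ∑ i, muE n p (fun x => grad n i (incr n p f k) x ^ 2) := a1.trans a2
      linarith
  have tot := Finset.sum_le_sum fun k (_ : k ∈ Finset.univ) => step k
  rw [Finset.sum_sub_distrib, Finset.sum_add_distrib, ← Finset.sum_mul, hsum, ← Finset.mul_sum,
    Finset.sum_comm] at tot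
  have e : ∑ _k : Fin n, V / n = V := by
    simp
    field_simp
  rw [e] at tot
  have last : ∑ i, ∑ k, muE n p (fun x => grad n i (incr n p f k) x ^ 2) ≤
      ∑ i, muE n p (fun x => grad n i f x ^ 2) :=
    Finset.sum_le_sum fun i _ => incr_grad_sum n p hp' f i
  linarith

/-! ### Indicators, symmetry, Russo -/

/-- Indicator function of `A`. -/
noncomputable def indA (n : ℕ) (A : Finset (Fin n → Bool)) (x : Fin n → Bool) : ℝ :=
  if x ∈ A then 1 else 0

lemma muE_indA (n : ℕ) (p : ℝ) (A : Finset (Fin n → Bool)) :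
    muE n p (indA n A) = muP n p A := by
  simp [muE, muP, indA]

lemma varE_indA (n : ℕ) (p : ℝ) (A : Finset (Fin n → Bool)) :
    varE n p (indA n A) = muP n p A * (1 - muP n p A) := by
  have : (fun x => indA n A x ^ 2) = indA n A := by
    funext x
    unfold indA
    split_ifs <;> norm_num
  unfold varE
  rw [this, muE_indA]
  ring

lemma grad_indA (n : ℕ) (A : Finset (Fin n → Bool)) (hA : MonotoneSet n A) (i : Fin n) (x) :
    grad n i (indA n A) x = 0 ∨ grad n i (indA n A) x = 1 := by
  have h := hA (Function.update x i false) 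
  unfold grad indA
  by_cases h0 : Function.update x i false ∈ A
  · have h1 := h h0 (Function.update x i true) (by
      intro j
      by_cases hj : j = i
      · subst hj; simp
      · simp [Function.update_of_ne hj])
    simp [h0, h1]
  · by_cases h1 : Function.update x i true ∈ A <;> simp [h0, h1]

lemma russo (n : ℕ) (p : ℝ) (A : Finset (Fin n → Bool)) :
    HasDerivAt (fun p => muP n p A) (∑ i, muE n p (grad n i (indA n A))) p := by
  have hW : ∀ x : Fin n → Bool, HasDerivAt (fun p => muW n p x)
      (∑ i, restW n p i x * (if x i then 1 else -1)) p := by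
    intro x
    have := HasDerivAt.fun_finsetProd (u := (Finset.univ : Finset (Fin n)))
      (f := fun i (p : ℝ) => if x i then p else 1 - p)
      (f' := fun i => if x i then (1 : ℝ) else -1) (x := p) (by
        intro i _
        cases x i
        · simpa using (hasDerivAt_id p).const_sub 1
        · simpa using hasDerivAt_id' p)
    simpa [muW, restW, smul_eq_mul] using this
  have hs := HasDerivAt.fun_sum (u := A) (fun x _ => hW x)
  unfold muP
  refine hs.congr_deriv ?_
  rw [Finset.sum_comm]
  apply Finset.sum_congr rfl
  intro i _
  rw [← russo_aux]
  simp [indA]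

lemma infl_eq (n : ℕ) (p : ℝ) (A : Finset (Fin n → Bool)) (hsym : SymmetricSet n A) (i j : Fin n) :
    muE n p (grad n i (indA n A)) = muE n p (grad n j (indA n A)) := by
  obtain ⟨G, htr, hinv⟩ := hsym
  obtain ⟨g, hg, rfl⟩ := htr i j
  have hind : ∀ x : Fin n → Bool, indA n A (fun k => x (g⁻¹ k)) = indA n A x := by
    intro x
    have : (fun k => x (g⁻¹ k)) ∈ A ↔ x ∈ A := by
      constructor
      · intro h
        have := hinv g⁻¹ (G.inv_mem hg) _ h
        simpa using this
      · exact hinv g hg x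
    unfold indA
    simp only [this]
  unfold muE
  rw [← Equiv.sum_comp (Equiv.arrowCongr g (Equiv.refl Bool))
    (fun x => muW n p x * grad n (g i) (indA n A) x)]
  apply Finset.sum_congr rfl
  intro x _
  have hx : (Equiv.arrowCongr g (Equiv.refl Bool)) x = fun k => x (g⁻¹ k) := by
    funext k
    rfl
  rw [hx]
  have hu : ∀ b, Function.update (fun k => x (g⁻¹ k)) (g i) b =
      fun k => (Function.update x i b) (g⁻¹ k) := by
    intro b
    funext k
    by_cases hk : k = g i
    · subst hk; simp
    · have : g⁻¹ k ≠ i := by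
        intro h
        apply hk
        rw [← h]
        simp
      rw [Function.update_of_ne hk, Function.update_of_ne this]
  congr 1
  · unfold muW
    exact (Equiv.prod_comp g⁻¹ (fun k => if x k then p else 1 - p)).symm
  · unfold grad
    rw [hu, hu, hind, hind]

lemma muP_pos (n : ℕ) (p : ℝ) (hp : p ∈ Set.Ioo (0 : ℝ) 1) (A : Finset (Fin n → Bool))
    (hne : A.Nonempty) : 0 < muP n p A :=
  Finset.sum_pos (fun x _ => muW_pos n p hp x) hne

lemma muP_lt_one (n : ℕ) (p : ℝ) (hp : p ∈ Set.Ioo (0 : ℝ) 1) (A : Finset (Fin n → Bool))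
    (hnu : A ≠ Finset.univ) : muP n p A < 1 := by
  rw [← sum_muW n p]
  obtain ⟨x, hx⟩ : ∃ x, x ∉ A := by
    by_contra hcon
    push Not at hcon
    exact hnu (Finset.eq_univ_iff_forall.mpr hcon)
  exact Finset.sum_lt_sum_of_subset (Finset.subset_univ A) (Finset.mem_univ x) hx (muW_pos n p hp x)
    fun y _ _ => (muW_pos n p hp y).le

/-- The differential inequality. -/
lemma deriv_bound (n : ℕ) (hn : 2 ≤ n) (p : ℝ) (hp : p ∈ Set.Ioo (0 : ℝ) 1)
    (A : Finset (Fin n → Bool)) (hmono : MonotoneSet n A) (hsym : SymmetricSet n A)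
    (hne : A.Nonempty) (hnu : A ≠ Finset.univ) :
    2 * sseq n * (muP n p A * (1 - muP n p A)) ≤ ∑ i, muE n p (grad n i (indA n A)) := by
  obtain ⟨s0, s1, s2⟩ := sseq_bounds n hn
  have h0 := muP_pos n p hp A hne
  have h1 := muP_lt_one n p hp A hnu
  have hnpos : (0 : ℝ) < n := by
    have : 0 < n := by omega
    exact_mod_cast this
  have hxpos : 0 < Real.log n := Real.log_pos (by exact_mod_cast hn)
  set I := ∑ i, muE n p (grad n i (indA n A)) with hI
  have habs : ∀ i, (fun x => |grad n i (indA n A) x|) = grad n i (indA n A) := by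
    intro i
    funext x
    rcases grad_indA n A hmono i x with h | h <;> rw [h] <;> simp
  have hsq : ∀ i, (fun x => grad n i (indA n A) x ^ 2) = grad n i (indA n A) := by
    intro i
    funext x
    rcases grad_indA n A hmono i x with h | h <;> rw [h] <;> simp
  have hIi : ∀ i, muE n p (grad n i (indA n A)) = I / n := by
    intro i
    have : I = n * muE n p (grad n i (indA n A)) := by
      rw [hI, Finset.sum_congr rfl (fun j _ => infl_eq n p A hsym j i)]
      simp
    rw [this]
    field_simp
  have hVeq := varE_indA n p A
  have hVpos : 0 < varE n p (indA n A) := by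
    rw [hVeq]
    exact mul_pos h0 (by linarith)
  have hV4 : varE n p (indA n A) ≤ 1 / 4 := by
    rw [hVeq]
    nlinarith [sq_nonneg (2 * muP n p A - 1)]
  obtain ⟨hb, hmain⟩ := main_ineq n p hp (indA n A) (I / n / 2) hVpos (by
    intro i
    rw [habs, hIi]
    linarith)
  simp only [hsq] at hmain
  rw [← hVeq]
  rw [← hI] at hmain
  generalize varE n p (indA n A) = V at *
  set s := sseq n
  by_contra hcon
  push Not at hcon
  -- the parameter bound: `I / n / 2 < s V / n`
  have hb2 : I / n / 2 ≤ s * V / n := by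
    rw [div_div, div_le_div_iff₀ (by positivity) hnpos]
    nlinarith
  have l1 : Real.log (I / n / 2) ≤ Real.log s + Real.log V - Real.log n := by
    refine (Real.log_le_log hb hb2).trans ?_
    rw [Real.log_div (by positivity) hnpos.ne', Real.log_mul s0.ne' hVpos.ne']
  have l2 : Real.log (V / n) = Real.log V - Real.log n := Real.log_div hVpos.ne' hnpos.ne'
  have l3 : Real.log V ≤ - (2 * Real.log 2) := by
    refine (Real.log_le_log hVpos hV4).trans ?_
    rw [show (1 / 4 : ℝ) = (2 ^ 2)⁻¹ by norm_num, Real.log_inv, Real.log_pow]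
    norm_num
  have l4 : Real.log s ≤ Real.log 2 + Real.log (Real.log n) := by
    refine (Real.log_le_log s0 s1).trans ?_
    rw [Real.log_mul (by norm_num) hxpos.ne']
  have l5 : s ≤ Real.log (V / n) - 2 * Real.log (I / n / 2) := by linarith
  have l6 := mul_le_mul_of_nonneg_left l5 hVpos.le
  nlinarith

/-- Corollary 4.3, inequality (19): for every `n ≥ 2`, `ε ∈ (0,1/2)` and
every nontrivial monotone symmetric `A ⊆ {0,1}^n`, `τ(A,ε) ≤ log((1-ε)/ε)/s(n)`. -/
theorem stmt17 (n : ℕ) (hn : 2 ≤ n) (ε : ℝ) (hε : ε ∈ Set.Ioo (0 : ℝ) (1 / 2))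
    (A : Finset (Fin n → Bool))
    (hmono : MonotoneSet n A) (hsym : SymmetricSet n A)
    (hne : A.Nonempty) (hnu : A ≠ Finset.univ)
    (pe p1e : ℝ)
    (hpe : pe ∈ Set.Ioo (0 : ℝ) 1) (hpeval : muP n pe A = ε)
    (hp1e : p1e ∈ Set.Ioo (0 : ℝ) 1) (hp1eval : muP n p1e A = 1 - ε) :
    p1e - pe ≤ Real.log ((1 - ε) / ε) / sseq n := by
  obtain ⟨s0, -, -⟩ := sseq_bounds n hn
  obtain ⟨he0, he1⟩ := hε
  have hlogpos : 0 < Real.log ((1 - ε) / ε) := by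
    apply Real.log_pos
    rw [lt_div_iff₀ he0]
    linarith
  rw [le_div_iff₀ s0]
  rcases le_total p1e pe with hle | hle
  · nlinarith
  set φ : ℝ → ℝ := fun p => Real.log (muP n p A) - Real.log (1 - muP n p A) with hφ
  have hsub : ∀ p ∈ Set.Icc pe p1e, p ∈ Set.Ioo (0 : ℝ) 1 := fun p hp =>
    ⟨hpe.1.trans_le hp.1, hp.2.trans_lt hp1e.2⟩
  have hder : ∀ p ∈ Set.Ioo (0 : ℝ) 1, HasDerivAt φ
      ((∑ i, muE n p (grad n i (indA n A))) / muP n p A -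
        (-(∑ i, muE n p (grad n i (indA n A)))) / (1 - muP n p A)) p := by
    intro p hp
    have h0 := muP_pos n p hp A hne
    have h1 := muP_lt_one n p hp A hnu
    have hr := russo n p A
    exact (hr.log h0.ne').sub ((hr.const_sub 1).log (by linarith))
  have key := Convex.mul_sub_le_image_sub_of_le_deriv (convex_Icc pe p1e) (f := φ)
    (fun p hp => (hder p (hsub p hp)).continuousAt.continuousWithinAt)
    (fun p hp => (hder p (hsub p (interior_subset hp))).differentiableAt.differentiableWithinAt)
    (C := 2 * sseq n) (by
      intro p hp
      have hp' := hsub p (interior_subset hp)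
      rw [(hder p hp').deriv]
      have h0 := muP_pos n p hp' A hne
      have h1 := muP_lt_one n p hp' A hnu
      have h2 : 0 < 1 - muP n p A := by linarith
      have hb := deriv_bound n hn p hp' A hmono hsym hne hnu
      have e : (∑ i, muE n p (grad n i (indA n A))) / muP n p A -
        (-(∑ i, muE n p (grad n i (indA n A)))) / (1 - muP n p A) =
        (∑ i, muE n p (grad n i (indA n A))) / (muP n p A * (1 - muP n p A)) := by
        field_simp
        ring
      rw [e, le_div_iff₀ (mul_pos h0 h2)]
      exact hb)
    pe ⟨le_rfl, hle⟩ p1e ⟨hle, le_rfl⟩ hle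
  simp only [hφ, hpeval, hp1eval] at key
  rw [Real.log_div (by linarith) he0.ne']
  have e : 1 - (1 - ε) = ε := by ring
  rw [e] at key
  linarith
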